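/- For any two vectors x, x' ∈ ℂ^N, the variation of the energy satisfies E(x') − E(x) ≤ −Σ_{i=1}^N Re(conj(h_i(x))·(x'_i − x_i)), where h_i(x) = Σ_{ξ=1}^P w_ξ(x)·u_i^ξ is the activation potential of the i-th neuron at state x. -/

import Mathlib

open scoped Classical

/-- Correlation `Σ_i Re(conj(u_i^ξ)·x_i)` of a state with the `ξ`-th fundamental memory. -/
noncomputable def cOverlap {N P : ℕ} (u : Fin P → Fin N → ℂ) (x : Fin N → ℂ) (ξ : Fin P) : ℝ :=
  ∑ i, ((starRingEnd ℂ) (u ξ i) * x i).re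

/-- Activation potential `h_i(x) = Σ_ξ w_ξ(x)·u_i^ξ` with `w_ξ(x) = f(cOverlap u x ξ)`. -/
noncomputable def cPot {N P : ℕ} (f : ℝ → ℝ) (u : Fin P → Fin N → ℂ) (x : Fin N → ℂ)
    (i : Fin N) : ℂ :=
  ∑ ξ, (f (cOverlap u x ξ) : ℂ) * u ξ i

/-- Energy of the complex-valued recurrent correlation neural network. -/
noncomputable def cEnergy {N P : ℕ} (F : ℝ → ℝ) (u : Fin P → Fin N → ℂ) (x : Fin N → ℂ) : ℝ :=
  -∑ ξ, F (cOverlap u x ξ)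

theorem aux_tangent (f F : ℝ → ℝ) (hmono : Monotone f)
    (hF : ∀ t : ℝ, HasDerivAt F (f t) t) (a b : ℝ) : f a * (b - a) ≤ F b - F a := by
  have hc : Continuous F := continuous_iff_continuousAt.2 fun t => (hF t).continuousAt
  rcases lt_trichotomy a b with h | h | h
  · obtain ⟨c, hc1, hc2⟩ := exists_hasDerivAt_eq_slope F f h hc.continuousOn (fun t _ => hF t)
    have h1 : f a ≤ f c := hmono hc1.1.le
    rw [eq_div_iff (by linarith)] at hc2
    nlinarith
  · subst h; simp
  · obtain ⟨c, hc1, hc2⟩ := exists_hasDerivAt_eq_slope F f h hc.continuousOn (fun t _ => hF t)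
    have h1 : f c ≤ f a := hmono hc1.2.le
    rw [eq_div_iff (by linarith)] at hc2
    nlinarith

/-- The variation of the energy of the complex-valued RCNN satisfies
`E(x') - E(x) ≤ -Σ_i Re(conj(h_i(x))·(x'_i - x_i))`. -/
theorem complex_energy_variation {N P : ℕ} (hN : 1 ≤ N) (hP : 1 ≤ P)
    (f F : ℝ → ℝ) (hf : Continuous f) (hmono : Monotone f)
    (hF : ∀ t : ℝ, HasDerivAt F (f t) t)
    (u : Fin P → Fin N → ℂ) (x x' : Fin N → ℂ) :
    cEnergy F u x' - cEnergy F u x ≤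
      -∑ i, ((starRingEnd ℂ) (cPot f u x i) * (x' i - x i)).re := by
  have key : ∑ i, ((starRingEnd ℂ) (cPot f u x i) * (x' i - x i)).re
      = ∑ ξ, f (cOverlap u x ξ) * (cOverlap u x' ξ - cOverlap u x ξ) := by
    have h1 : ∀ i, ((starRingEnd ℂ) (cPot f u x i) * (x' i - x i)).re
        = ∑ ξ, f (cOverlap u x ξ) * (((starRingEnd ℂ) (u ξ i) * x' i).re
          - ((starRingEnd ℂ) (u ξ i) * x i).re) := by
      intro i
      unfold cPot
      rw [map_sum, Finset.sum_mul, Complex.re_sum]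
      refine Finset.sum_congr rfl fun ξ _ => ?_
      rw [map_mul, Complex.conj_ofReal, mul_assoc, Complex.re_ofReal_mul, mul_sub, Complex.sub_re]
    rw [Finset.sum_congr rfl fun i _ => h1 i, Finset.sum_comm]
    refine Finset.sum_congr rfl fun ξ _ => ?_
    rw [← Finset.mul_sum, Finset.sum_sub_distrib]
    rfl
  have h2 : ∑ ξ, f (cOverlap u x ξ) * (cOverlap u x' ξ - cOverlap u x ξ)
      ≤ ∑ ξ, (F (cOverlap u x' ξ) - F (cOverlap u x ξ)) :=
    Finset.sum_le_sum fun ξ _ => aux_tangent f F hmono hF _ _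
  rw [Finset.sum_sub_distrib] at h2
  rw [key]
  unfold cEnergy
  linarith
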